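/- arXiv:1510.02558 — 3 statements merged into one kernel-verified Lean document; each statement's English description precedes it below -/
import Mathlib

section
/- Let m ≥ 1, let D ⊆ ℝ^m be a nonempty compact convex set, and let L : ℝ^m → ℝ be differentiable and convex. Suppose there is a constant C_l ≥ 0 such that for all f, g ∈ D and all λ ∈ [0,1], L(f + λ·(g − f)) ≤ L(f) + λ·⟪g − f, ∇L(f)⟫ + (λ²/2)·C_l (smooth empirical risk assumption). Let F* ∈ D be a minimizer of L over D. Define Frank–Wolfe iterates: F₀ ∈ D arbitrary, and for each t ≥ 0, choose h_t ∈ D with ⟪h_t, ∇L(F_t)⟫ = min_{s∈D} ⟪s, ∇L(F_t)⟫, set γ_t = 2/(t+2) and F_{t+1} = (1 − γ_t)·F_t + γ_t·h_t. Then for every t ≥ 1, L(F_t) − L(F*) ≤ 2·C_l/(t + 2). -/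
open scoped RealInnerProductSpace

/-- First-order characterization of convexity: a convex function lies above its tangent planes. -/
theorem ConvexOn.add_inner_le_of_hasGradientAt {E : Type*} [NormedAddCommGroup E]
    [InnerProductSpace ℝ E] [CompleteSpace E] {L : E → ℝ} (hL : ConvexOn ℝ Set.univ L)
    {x g : E} (hg : HasGradientAt L g x) (y : E) : L x + ⟪y - x, g⟫ ≤ L y := by
  have hline : ConvexOn ℝ Set.univ (L ∘ AffineMap.lineMap (k := ℝ) x y) :=
    hL.comp_affineMap (AffineMap.lineMap x y)
  have hd : HasDerivAt (L ∘ AffineMap.lineMap (k := ℝ) x y) ⟪g, y - x⟫ 0 := by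
    have hf := hg.hasFDerivAt
    rw [← AffineMap.lineMap_apply_zero (k := ℝ) x y] at hf
    simpa using hf.comp_hasDerivAt (0 : ℝ) (AffineMap.hasDerivAt_lineMap (a := x) (b := y))
  have hs := hline.le_slope_of_hasDerivAt (Set.mem_univ 0) (Set.mem_univ 1) one_pos hd
  rw [real_inner_comm] at hs
  simp [slope_def_field] at hs
  linarith

/-- Convergence of the Frank–Wolfe boosting iterates under the smooth empirical risk
assumption: with exact linearized subproblems and step sizes `γ_t = 2/(t+2)`,
`L(F_t) − L(F*) ≤ 2·C_l/(t+2)` for all `t ≥ 1`. -/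
theorem fw_boost_convergence (m : ℕ) (hm : 1 ≤ m)
    (D : Set (EuclideanSpace ℝ (Fin m))) (hDne : D.Nonempty)
    (hDcpt : IsCompact D) (hDcvx : Convex ℝ D)
    (L : EuclideanSpace ℝ (Fin m) → ℝ)
    (grad : EuclideanSpace ℝ (Fin m) → EuclideanSpace ℝ (Fin m))
    (hgrad : ∀ z, HasGradientAt L (grad z) z)
    (hconv : ConvexOn ℝ Set.univ L)
    (Cl : ℝ) (hCl : 0 ≤ Cl)
    (hsmooth : ∀ f ∈ D, ∀ g ∈ D, ∀ lam ∈ Set.Icc (0 : ℝ) 1,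
      L (f + lam • (g - f)) ≤ L f + lam * ⟪g - f, grad f⟫ + lam ^ 2 / 2 * Cl)
    (Fstar : EuclideanSpace ℝ (Fin m)) (hFstar : Fstar ∈ D)
    (hmin : ∀ s ∈ D, L Fstar ≤ L s)
    (F h : ℕ → EuclideanSpace ℝ (Fin m)) (hF0 : F 0 ∈ D)
    (hhD : ∀ t, h t ∈ D)
    (hharg : ∀ t, ∀ s ∈ D, ⟪h t, grad (F t)⟫ ≤ ⟪s, grad (F t)⟫)
    (hupd : ∀ t : ℕ, F (t + 1) =
      (1 - 2 / ((t : ℝ) + 2)) • F t + (2 / ((t : ℝ) + 2)) • h t) :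
    ∀ t : ℕ, 1 ≤ t → L (F t) - L Fstar ≤ 2 * Cl / ((t : ℝ) + 2) := by
  have hγ (t : ℕ) : 2 / ((t : ℝ) + 2) ∈ Set.Icc (0 : ℝ) 1 :=
    ⟨by positivity, (div_le_one (by positivity)).2 (by linarith [t.cast_nonneg (α := ℝ)])⟩
  have hFD (t : ℕ) : F t ∈ D := by
    induction t with
    | zero => exact hF0
    | succ t ih =>
      rw [hupd t]
      exact hDcvx ih (hhD t) (sub_nonneg.2 (hγ t).2) (hγ t).1 (by ring)
  have hstep (t : ℕ) : L (F (t + 1)) - L Fstar ≤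
      (1 - 2 / ((t : ℝ) + 2)) * (L (F t) - L Fstar) + (2 / ((t : ℝ) + 2)) ^ 2 / 2 * Cl := by
    have hdescent := hsmooth (F t) (hFD t) (h t) (hhD t) _ (hγ t)
    have htangent := hconv.add_inner_le_of_hasGradientAt (hgrad (F t)) Fstar
    have hoptimal := hharg t Fstar hFstar
    have hF : F (t + 1) = F t + (2 / ((t : ℝ) + 2)) • (h t - F t) := by
      rw [hupd t]
      module
    rw [← hF, inner_sub_left] at hdescent
    rw [inner_sub_left] at htangent
    have hgap : ⟪h t, grad (F t)⟫ - ⟪F t, grad (F t)⟫ ≤ L Fstar - L (F t) := by linarith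
    linarith [mul_le_mul_of_nonneg_left hgap (hγ t).1]
  intro t ht
  induction t, ht using Nat.le_induction with
  | base =>
    have h0 := hstep 0
    norm_num at h0 ⊢
    linarith
  | succ t ht ih =>
    calc L (F (t + 1)) - L Fstar
        ≤ (1 - 2 / ((t : ℝ) + 2)) * (2 * Cl / ((t : ℝ) + 2))
            + (2 / ((t : ℝ) + 2)) ^ 2 / 2 * Cl :=
          (hstep t).trans (by gcongr; exact sub_nonneg.2 (hγ t).2)
      _ = 2 * Cl * (((t : ℝ) + 1) / ((t : ℝ) + 2) ^ 2) := by
          field_simp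
          ring
      _ ≤ 2 * Cl * (1 / ((t : ℝ) + 3)) := by
          refine mul_le_mul_of_nonneg_left ?_ (by positivity)
          rw [div_le_div_iff₀ (by positivity) (by positivity)]
          nlinarith
      _ = 2 * Cl / (((t + 1 : ℕ) : ℝ) + 2) := by
          push_cast
          ring
end

section
/- Let C > 0, let p be a natural number with p ≥ 2, let a, b, y ∈ [−C, C], and let λ ∈ [0,1]. Then for the l_p loss l(a,y) = |a − y|^p / p: |a + λ·(b − a) − y|^p / p ≤ |a − y|^p / p + λ·(b − a)·(a − y)·|a − y|^{p−2} + (λ²/2)·(p − 1)·(2C)^p. -/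
/-- One step of the recursion for the second-order Taylor remainder of `x ↦ |x| ^ n`. -/
lemma abs_remainder_step (q u v : ℝ) (hq : 0 ≤ q) :
    |v| * u ^ 2 - |u| * u ^ 2 - (q + 3) * (v - u) * u * |u| + (q + 2) * |v| * ((v - u) * u)
      ≤ (q + 2) * |u| * (v - u) ^ 2 := by
  rcases abs_cases u with ⟨hu, hu'⟩ | ⟨hu, hu'⟩ <;>
    rcases abs_cases v with ⟨hv, hv'⟩ | ⟨hv, hv'⟩ <;> rw [hu, hv]
  · exact le_of_eq (by ring)
  · have h₁ : 0 ≤ u * (-v) ^ 2 := by positivity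
    have h₂ : 0 ≤ u ^ 2 * (-v) := mul_nonneg (sq_nonneg u) (by linarith)
    nlinarith [mul_nonneg hq h₁, mul_nonneg hq h₂]
  · have h₁ : 0 ≤ (-u) * v ^ 2 := mul_nonneg (by linarith) (sq_nonneg v)
    have h₂ : 0 ≤ u ^ 2 * v := by positivity
    nlinarith [mul_nonneg hq h₁, mul_nonneg hq h₂]
  · exact le_of_eq (by ring)

/-- Second-order Taylor bound for `x ↦ |x| ^ (q + 2)` on `[-M, M]`. -/
lemma abs_pow_le_taylor {M u v : ℝ} (hu : |u| ≤ M) (hv : |v| ≤ M) (q : ℕ) :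
    |v| ^ (q + 2) ≤ |u| ^ (q + 2) + (q + 2) * ((v - u) * (u * |u| ^ q))
      + (q + 2) * (q + 1) / 2 * ((v - u) ^ 2 * M ^ q) := by
  have hM : 0 ≤ M := (abs_nonneg u).trans hu
  induction q with
  | zero =>
    simp only [zero_add, sq_abs, pow_zero, Nat.cast_zero]
    exact le_of_eq (by ring)
  | succ q ih =>
    have h₁ := mul_le_mul_of_nonneg_left ih (abs_nonneg v)
    have h₂ := mul_le_mul_of_nonneg_left (abs_remainder_step q u v q.cast_nonneg)
      (pow_nonneg (abs_nonneg u) q)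
    have h₃ : |v| * ((q + 2) * (q + 1) / 2 * ((v - u) ^ 2 * M ^ q))
        ≤ M * ((q + 2) * (q + 1) / 2 * ((v - u) ^ 2 * M ^ q)) := by gcongr
    have h₄ : (q + 2) * (v - u) ^ 2 * |u| ^ (q + 1)
        ≤ (q + 2) * (v - u) ^ 2 * M ^ (q + 1) := by gcongr
    have e₂ : |u| ^ (q + 2) = |u| ^ q * u ^ 2 := by rw [pow_add, sq_abs]
    have e₃ : |u| ^ (q + 1 + 2) = |u| ^ q * |u| * u ^ 2 := by rw [pow_add, sq_abs, pow_succ]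
    rw [e₂] at h₁
    rw [e₃]
    rw [pow_succ] at h₄
    push_cast
    simp only [pow_succ, pow_zero, one_mul] at h₁ h₂ h₃ h₄ ⊢
    linarith

/-- Smooth empirical risk bound for the `l_p` loss `l(a,y) = |a−y|^p/p` (`p ≥ 2`) on
`[-C, C]`, with constant `C_{l,F^C} = (p−1)·(2C)^p`. -/
theorem lp_loss_smooth (C : ℝ) (hC : 0 < C) (p : ℕ) (hp : 2 ≤ p)
    (a b y : ℝ) (ha : a ∈ Set.Icc (-C) C) (hb : b ∈ Set.Icc (-C) C)
    (hy : y ∈ Set.Icc (-C) C) (lam : ℝ) (hlam : lam ∈ Set.Icc (0 : ℝ) 1) :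
    |a + lam * (b - a) - y| ^ p / (p : ℝ) ≤
      |a - y| ^ p / (p : ℝ) + lam * (b - a) * ((a - y) * |a - y| ^ (p - 2))
        + lam ^ 2 / 2 * (((p : ℝ) - 1) * (2 * C) ^ p) := by
  obtain ⟨q, rfl⟩ := Nat.exists_eq_add_of_le' hp
  obtain ⟨ha₁, ha₂⟩ := ha
  obtain ⟨hb₁, hb₂⟩ := hb
  obtain ⟨hy₁, hy₂⟩ := hy
  obtain ⟨hl₀, hl₁⟩ := hlam
  have hu : |a - y| ≤ 2 * C := abs_le.2 ⟨by linarith, by linarith⟩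
  have hv : |a + lam * (b - a) - y| ≤ 2 * C := abs_le.2 ⟨by nlinarith, by nlinarith⟩
  have hba : (b - a) ^ 2 ≤ (2 * C) ^ 2 := sq_le_sq' (by linarith) (by linarith)
  have hT := abs_pow_le_taylor hu hv q
  have hd : a + lam * (b - a) - y - (a - y) = lam * (b - a) := by ring
  rw [hd] at hT
  have hK : ((q : ℝ) + 2) * (q + 1) / 2 * ((lam * (b - a)) ^ 2 * (2 * C) ^ q)
      ≤ (q + 2) * (q + 1) / 2 * (lam ^ 2 * (2 * C) ^ 2 * (2 * C) ^ q) := by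
    rw [mul_pow]
    gcongr
  have hq : (0 : ℝ) < q + 2 := by positivity
  rw [Nat.add_sub_cancel]
  push_cast
  rw [div_le_iff₀ hq, add_mul, add_mul, div_mul_cancel₀ _ hq.ne', pow_add (2 * C)]
  linarith
end

section
/- Let C ≥ 0 and let ε : ℕ → ℝ be a sequence with ε_t ≥ 0 for all t, satisfying for every t ≥ 0 the recursion ε_{t+1} ≤ (1 − 2/(t+2))·ε_t + (2/(t+2))²·(C/2). Then for every t ≥ 1, ε_t ≤ 2·C/(t + 2). -/
/-- Induction lemma for the `O(1/t)` Frank–Wolfe rate: if a nonnegative sequence satisfies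
`ε_{t+1} ≤ (1 - 2/(t+2))·ε_t + (2/(t+2))²·(C/2)`, then `ε_t ≤ 2C/(t+2)` for all `t ≥ 1`. -/
theorem fw_rate_recursion (C : ℝ) (hC : 0 ≤ C) (ε : ℕ → ℝ) (hε : ∀ t, 0 ≤ ε t)
    (hrec : ∀ t : ℕ, ε (t + 1) ≤ (1 - 2 / ((t : ℝ) + 2)) * ε t + (2 / ((t : ℝ) + 2)) ^ 2 * (C / 2)) :
    ∀ t : ℕ, 1 ≤ t → ε t ≤ 2 * C / ((t : ℝ) + 2) := by
  intro t ht
  induction t, ht using Nat.le_induction with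
  | base =>
    have h := hrec 0
    norm_num at h ⊢
    linarith
  | succ t ht ih =>
    have hs : (0 : ℝ) < (t : ℝ) + 2 := by positivity
    have hγ : 0 ≤ 1 - 2 / ((t : ℝ) + 2) := by
      rw [sub_nonneg, div_le_one hs]
      linarith [t.cast_nonneg (α := ℝ)]
    calc ε (t + 1)
        ≤ (1 - 2 / ((t : ℝ) + 2)) * ε t + (2 / ((t : ℝ) + 2)) ^ 2 * (C / 2) := hrec t
      _ ≤ (1 - 2 / ((t : ℝ) + 2)) * (2 * C / ((t : ℝ) + 2))
          + (2 / ((t : ℝ) + 2)) ^ 2 * (C / 2) := by gcongr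
      _ = 2 * C * ((t : ℝ) + 1) / ((t : ℝ) + 2) ^ 2 := by
        field_simp
        ring
      _ ≤ 2 * C / (((t + 1 : ℕ) : ℝ) + 2) := by
        rw [div_le_div_iff₀ (by positivity) (by positivity)]
        push_cast
        nlinarith
end
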